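/- Let M be a generator-cogenerator of mod-Λ and d ≥ 2 an integer. Then gldim End_Λ(M) ≤ d if and only if Mdim_M(X) ≤ d − 2 for every indecomposable Λ-module X. -/

import Mathlib

open CategoryTheory CategoryTheory.Limits Opposite

universe u

namespace Rigidity

variable (Λ : Type u) [Ring Λ]

/-- `X` belongs to `add M`: it is a direct summand of a finite direct sum of copies of `M`. -/
def InAdd (M X : ModuleCat.{u} Λ) : Prop :=
  ∃ (r : ℕ) (Y : ModuleCat.{u} Λ), Nonempty ((X ⊞ Y) ≅ ⨁ (fun _ : Fin r => M))

/-- An indecomposable object. -/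
def Indec (X : ModuleCat.{u} Λ) : Prop :=
  ¬ IsZero X ∧ ∀ A B : ModuleCat.{u} Λ, Nonempty (X ≅ A ⊞ B) → IsZero A ∨ IsZero B

/-- A generator-cogenerator: `add M` contains the regular module and all
finitely generated injective modules. -/
def IsGenCogen (M : ModuleCat.{u} Λ) : Prop :=
  InAdd Λ M (ModuleCat.of Λ Λ) ∧
  ∀ I : ModuleCat.{u} Λ, Module.Finite Λ I → Injective I → InAdd Λ M I

/-- `g : A ⟶ X` is a right minimal `add M`-approximation. -/
def IsRMApprox (M : ModuleCat.{u} Λ) {A X : ModuleCat.{u} Λ} (g : A ⟶ X) : Prop :=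
  InAdd Λ M A ∧
  (∀ T : ModuleCat.{u} Λ, InAdd Λ M T → ∀ f : T ⟶ X, ∃ h : T ⟶ A, h ≫ g = f) ∧
  (∀ h : A ⟶ A, h ≫ g = g → IsIso h)

/-- `IsMSyzygy M X r W` : `W` is an `r`-th `M`-syzygy `Ω_M^r(X)` of `X`. -/
inductive IsMSyzygy (M : ModuleCat.{u} Λ) : ModuleCat.{u} Λ → ℕ → ModuleCat.{u} Λ → Prop
  | zero (X : ModuleCat.{u} Λ) : IsMSyzygy M X 0 X
  | succ (X : ModuleCat.{u} Λ) (r : ℕ) (W A : ModuleCat.{u} Λ) (g : A ⟶ W)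
      (hW : IsMSyzygy M X r W) (hg : IsRMApprox Λ M g) :
      IsMSyzygy M X (r + 1) (kernel g)

/-- The `M`-dimension of `X` is at most `r`. -/
def MdimLE (M X : ModuleCat.{u} Λ) (r : ℕ) : Prop :=
  ∃ W : ModuleCat.{u} Λ, IsMSyzygy Λ M X r W ∧ InAdd Λ M W

/-- projective dimension at most `r`, via a length `r` projective resolution. -/
def ProjDimLE (A : Type u) [Ring A] (N : ModuleCat.{u} A) (r : ℕ) : Prop :=
  ∃ (P : ℕ → ModuleCat.{u} A) (d : ∀ i : ℕ, P (i + 1) ⟶ P i) (f : P 0 ⟶ N),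
    (∀ i, Projective (P i)) ∧ (∀ i, r < i → IsZero (P i)) ∧ Epi f ∧
    (∃ w : d 0 ≫ f = 0, (ShortComplex.mk (d 0) f w).Exact) ∧
    (∀ i, ∃ w : d (i + 1) ≫ d i = 0, (ShortComplex.mk (d (i + 1)) (d i) w).Exact)

/-- global dimension at most `r`. -/
def GldimLE (A : Type u) [Ring A] (r : ℕ) : Prop :=
  ∀ N : ModuleCat.{u} A, ProjDimLE A N r

/-- the global dimension, as an element of `ℕ∞`. -/
noncomputable def gldim (A : Type u) [Ring A] : ℕ∞ :=
  sInf {c : ℕ∞ | ∃ r : ℕ, c = (r : ℕ∞) ∧ GldimLE A r}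

/-- dominant dimension at least `r`: there is an exact sequence
`0 → A → I^0 → ⋯ → I^(r-1)` with all `I^i` projective-injective. -/
def DomdimGE (A : Type u) [Ring A] (r : ℕ) : Prop :=
  ∃ (I : ℕ → ModuleCat.{u} A) (f : ModuleCat.of A A ⟶ I 0) (g : ∀ i : ℕ, I i ⟶ I (i + 1)),
    Mono f ∧ (∀ i, i < r → Injective (I i) ∧ Projective (I i)) ∧
    (2 ≤ r → ∃ w : f ≫ g 0 = 0, (ShortComplex.mk f (g 0) w).Exact) ∧
    (∀ i, i + 3 ≤ r → ∃ w : g i ≫ g (i + 1) = 0, (ShortComplex.mk (g i) (g (i + 1)) w).Exact)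

/-- the dominant dimension, as an element of `ℕ∞`. -/
noncomputable def domdim (A : Type u) [Ring A] : ℕ∞ :=
  sSup {c : ℕ∞ | ∃ r : ℕ, c = (r : ℕ∞) ∧ DomdimGE A r}

/-- the rigidity degree of a module, as an element of `ℕ∞`. -/
noncomputable def rigDeg [HasExt.{u} (ModuleCat.{u} Λ)] (M : ModuleCat.{u} Λ) : ℕ∞ :=
  sSup {c : ℕ∞ | ∃ r : ℕ, c = (r : ℕ∞) ∧ 0 < r ∧
    ∀ i : ℕ, 1 ≤ i → i ≤ r → Subsingleton (Abelian.Ext M M i)}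

/-- the rigidity dimension. -/
noncomputable def rigdim : ℕ∞ :=
  sSup {c : ℕ∞ | ∃ M : ModuleCat.{u} Λ, Module.Finite Λ M ∧ IsGenCogen Λ M ∧
    (∃ r : ℕ, GldimLE (End (op M)) r) ∧ c = domdim (End (op M))}

/-- An Auslander-Reiten (almost split) sequence. -/
def IsARSeq {X Y Z : ModuleCat.{u} Λ} (f : X ⟶ Y) (g : Y ⟶ Z) : Prop :=
  Mono f ∧ Epi g ∧ (∃ w : f ≫ g = 0, (ShortComplex.mk f g w).Exact) ∧
  Indec Λ X ∧ Indec Λ Z ∧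
  (¬ ∃ s : Z ⟶ Y, s ≫ g = 𝟙 Z) ∧
  (∀ (W : ModuleCat.{u} Λ) (h : W ⟶ Z), (¬ ∃ s : Z ⟶ W, s ≫ h = 𝟙 Z) →
    ∃ h' : W ⟶ Y, h' ≫ g = h)

/-- `X` has composition length `t`. -/
def HasCompLength (X : ModuleCat.{u} Λ) (t : ℕ) : Prop :=
  (∃ c : Fin (t + 1) → Submodule Λ X, StrictMono c ∧ c 0 = ⊥ ∧ c (Fin.last t) = ⊤) ∧
  ∀ r : ℕ, (∃ c : Fin (r + 1) → Submodule Λ X, StrictMono c ∧ c 0 = ⊥ ∧ c (Fin.last r) = ⊤) →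
    r ≤ t

section Homological

open Abelian

variable {A : Type u} [Ring A]

lemma baer_of_ext_one [HasExt.{u} (ModuleCat.{u} A)] (Y : ModuleCat.{u} A)
    (h : ∀ I : Submodule A A, Subsingleton (Ext (ModuleCat.of A (A ⧸ I)) Y 1)) :
    Module.Baer A Y := by
  intro I g
  let S : ShortComplex (ModuleCat.{u} A) := ShortComplex.mk
    (ModuleCat.ofHom I.subtype) (ModuleCat.ofHom I.mkQ)
    (by ext x; exact (Submodule.Quotient.mk_eq_zero I).2 x.2)
  have hS : S.ShortExact := ModuleCat.shortComplex_shortExact S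
    (LinearMap.exact_subtype_mkQ I) I.injective_subtype I.mkQ_surjective
  have := h I
  obtain ⟨x, hx⟩ := Ext.contravariant_sequence_exact₁ hS Y
    (Ext.mk₀ (ModuleCat.ofHom g)) (n₁ := 1) rfl (Subsingleton.elim (α := Ext S.X₃ Y 1) _ _)
  obtain ⟨φ, rfl⟩ := Ext.addEquiv₀.symm.surjective x
  rw [Ext.addEquiv₀_symm_apply, Ext.mk₀_comp_mk₀] at hx
  have hφ : S.f ≫ φ = ModuleCat.ofHom g := Ext.addEquiv₀.symm.injective hx
  exact ⟨φ.hom, fun x hx ↦ ConcreteCategory.congr_hom hφ ⟨x, hx⟩⟩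

lemma hasInjectiveDimensionLT_of_ext_cyclic [HasExt.{u} (ModuleCat.{u} A)] (n : ℕ)
    (Y : ModuleCat.{u} A)
    (h : ∀ I : Submodule A A, Subsingleton (Ext (ModuleCat.of A (A ⧸ I)) Y (n + 1))) :
    HasInjectiveDimensionLT Y (n + 1) := by
  induction n generalizing Y with
  | zero =>
    have := Module.injective_object_of_injective_module A Y (inj := (baer_of_ext_one Y h).injective)
    exact inferInstanceAs (HasInjectiveDimensionLT Y 1)
  | succ n ih =>
    obtain ⟨⟨J, hJ, f, hf⟩⟩ := EnoughInjectives.presentation Y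
    let S := ShortComplex.mk f (cokernel.π f) (cokernel.condition f)
    have hS : S.ShortExact := { exact := ShortComplex.exact_cokernel f }
    refine (hS.hasInjectiveDimensionLT_X₃_iff n hJ).1 (ih _ fun I ↦ ⟨fun a b ↦ ?_⟩)
    have key : ∀ x : Ext (ModuleCat.of A (A ⧸ I)) S.X₃ (n + 1), x = 0 := fun x ↦ by
      obtain ⟨y, rfl⟩ := Ext.covariant_sequence_exact₃ _ hS x rfl
        ((h I).elim _ _)
      have : Injective S.X₂ := hJ
      rw [y.eq_zero_of_injective, Ext.zero_comp]
    exact (key a).trans (key b).symm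

/-- Auslander: the projective dimension of every module is bounded by that of cyclic modules. -/
lemma hasProjectiveDimensionLT_of_cyclic (n : ℕ)
    (h : ∀ I : Submodule A A, HasProjectiveDimensionLT (ModuleCat.of A (A ⧸ I)) (n + 1))
    (N : ModuleCat.{u} A) : HasProjectiveDimensionLT N (n + 1) := by
  have hY (Y : ModuleCat.{u} A) : HasInjectiveDimensionLT Y (n + 1) :=
    hasInjectiveDimensionLT_of_ext_cyclic n Y fun I ↦
      (h I).subsingleton (n := n + 1) _ _ le_rfl Y
  rw [hasProjectiveDimensionLT_iff]
  intro i hi Y e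
  exact Ext.eq_zero_of_hasInjectiveDimensionLT e (n + 1) hi

lemma ProjDimLE.hasProjectiveDimensionLT {N : ModuleCat.{u} A} {r : ℕ} (h : ProjDimLE A N r) :
    HasProjectiveDimensionLT N (r + 1) := by
  induction r generalizing N with
  | zero =>
    obtain ⟨P, d, f, hP, hz, hf, ⟨w, ex⟩, -⟩ := h
    have hd : d 0 = 0 := (hz 1 (by lia)).eq_of_src _ _
    have : Mono f := ex.mono_g hd
    have : IsIso f := isIso_of_mono_of_epi f
    have := hP 0
    exact hasProjectiveDimensionLT_of_iso (asIso f) 1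
  | succ r ih =>
    obtain ⟨P, d, f, hP, hz, hf, ⟨w, ex⟩, hex⟩ := h
    let S := ShortComplex.mk (kernel.ι f) f (kernel.condition f)
    have hS : S.ShortExact := { exact := ShortComplex.exact_kernel f }
    refine (hS.hasProjectiveDimensionLT_X₃_iff r (hP 0)).2 (ih ?_)
    have hl : Epi (kernel.lift f (d 0) w) := by
      simpa using (ShortComplex.exact_iff_epi_kernel_lift _).1 ex
    obtain ⟨w1, ex1⟩ := hex 0
    have w1' : d 1 ≫ kernel.lift f (d 0) w = 0 := by
      rw [← cancel_mono (kernel.ι f)]; simpa using w1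
    refine ⟨fun i ↦ P (i + 1), fun i ↦ d (i + 1), kernel.lift f (d 0) w, fun i ↦ hP _,
      fun i hi ↦ hz _ (by lia), hl, ⟨w1', ?_⟩, fun i ↦ hex _⟩
    let φ : ShortComplex.mk (d 1) (kernel.lift f (d 0) w) w1' ⟶ ShortComplex.mk (d 1) (d 0) w1 :=
      { τ₁ := 𝟙 _, τ₂ := 𝟙 _, τ₃ := kernel.ι f }
    have : Epi φ.τ₁ := inferInstanceAs (Epi (𝟙 _))
    have : IsIso φ.τ₂ := inferInstanceAs (IsIso (𝟙 _))
    have : Mono φ.τ₃ := inferInstanceAs (Mono (kernel.ι f))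
    exact (ShortComplex.exact_iff_of_epi_of_isIso_of_mono φ).2 ex1

lemma projDimLE_zero {N : ModuleCat.{u} A} [hN : Projective N] : ProjDimLE A N 0 := by
  obtain ⟨Q, rfl, hQ⟩ : ∃ Q : ℕ → ModuleCat.{u} A, Q 0 = N ∧ ∀ i, 0 < i → IsZero (Q i) := by
    refine ⟨fun i ↦ Nat.casesOn i N fun _ ↦ ModuleCat.of A PUnit, rfl, ?_⟩
    rintro (_ | i) hi
    · lia
    · exact ModuleCat.isZero_of_subsingleton (ModuleCat.of A PUnit)
  refine ⟨Q, fun _ ↦ 0, 𝟙 _, ?_, hQ, inferInstance, ⟨by simp, ?_⟩,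
    fun i ↦ ⟨by simp, ShortComplex.exact_of_isZero_X₂ _ (hQ _ i.succ_pos)⟩⟩
  · rintro (_ | i)
    · exact hN
    · exact (hQ _ i.succ_pos).projective
  · refine (ShortComplex.exact_iff_mono _ rfl).2 ?_
    dsimp
    infer_instance

lemma ProjDimLE.succ {P : ModuleCat.{u} A} [Projective P] {N : ModuleCat.{u} A}
    (g : P ⟶ N) [hg : Epi g] {r : ℕ} (h : ProjDimLE A (kernel g) r) :
    ProjDimLE A N (r + 1) := by
  obtain ⟨Q, d, f, hQ, hz, hf, ⟨w, ex⟩, hex⟩ := h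
  let Q' : ℕ → ModuleCat.{u} A := fun i ↦ Nat.casesOn i P Q
  let d' : ∀ i : ℕ, Q' (i + 1) ⟶ Q' i := fun i ↦ match i with
    | 0 => f ≫ kernel.ι g
    | i + 1 => d i
  refine ⟨Q', d', g, ?_, ?_, hg, ⟨?_, ?_⟩, ?_⟩
  · rintro (_ | i)
    · assumption
    · exact hQ i
  · rintro (_ | i) hi
    · lia
    · exact hz i (by lia)
  · exact (Category.assoc _ _ _).trans (by simp)
  · let φ : ShortComplex.mk (f ≫ kernel.ι g) g (by simp) ⟶
        ShortComplex.mk (kernel.ι g) g (kernel.condition g) :=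
      { τ₁ := f, τ₂ := 𝟙 _, τ₃ := 𝟙 _ }
    have : IsIso φ.τ₂ := inferInstanceAs (IsIso (𝟙 _))
    have : Mono φ.τ₃ := inferInstanceAs (Mono (𝟙 _))
    exact (ShortComplex.exact_iff_of_epi_of_isIso_of_mono φ).2 (ShortComplex.exact_kernel g)
  · rintro (_ | i)
    · refine ⟨(Category.assoc _ _ _).symm.trans ?_, ?_⟩
      · exact (congrArg (· ≫ kernel.ι g) w).trans zero_comp
      · let φ : ShortComplex.mk (d 0) f w ⟶ ShortComplex.mk (d 0) (f ≫ kernel.ι g)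
            ((Category.assoc _ _ _).symm.trans ((congrArg (· ≫ kernel.ι g) w).trans zero_comp)) :=
          { τ₁ := 𝟙 _, τ₂ := 𝟙 _, τ₃ := kernel.ι g }
        have : Epi φ.τ₁ := inferInstanceAs (Epi (𝟙 _))
        have : IsIso φ.τ₂ := inferInstanceAs (IsIso (𝟙 _))
        have : Mono φ.τ₃ := inferInstanceAs (Mono (kernel.ι g))
        exact (ShortComplex.exact_iff_of_epi_of_isIso_of_mono φ).1 ex
    · exact hex i

lemma projDimLE_of_hasProjectiveDimensionLT {N : ModuleCat.{u} A} {r : ℕ}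
    (h : HasProjectiveDimensionLT N (r + 1)) : ProjDimLE A N r := by
  induction r generalizing N with
  | zero =>
    have : Projective N := projective_iff_hasProjectiveDimensionLT_one.2 h
    exact projDimLE_zero
  | succ r ih =>
    obtain ⟨p⟩ := EnoughProjectives.presentation N
    let S := ShortComplex.mk (kernel.ι p.f) p.f (kernel.condition p.f)
    have hS : S.ShortExact := { exact := ShortComplex.exact_kernel p.f }
    exact .succ p.f (ih ((hS.hasProjectiveDimensionLT_X₃_iff r p.projective).1 h))

lemma hasProjectiveDimensionLT_quotient_range_iff {X P Q : ModuleCat.{u} A} (hP : Projective P)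
    (hQ : Projective Q) (f : X ⟶ P) (g : P ⟶ Q) (hf : Function.Injective f)
    (hfg : Function.Exact f g) (n : ℕ) :
    HasProjectiveDimensionLT (ModuleCat.of A (Q ⧸ LinearMap.range g.hom)) (n + 3) ↔
      HasProjectiveDimensionLT X (n + 1) := by
  let R := LinearMap.range g.hom
  let S : ShortComplex (ModuleCat.{u} A) := ShortComplex.mk f (ModuleCat.ofHom g.hom.rangeRestrict)
    (by ext x; exact hfg.apply_apply_eq_zero x)
  let T : ShortComplex (ModuleCat.{u} A) := ShortComplex.mk
    (ModuleCat.ofHom R.subtype) (ModuleCat.ofHom R.mkQ)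
    (by ext x; exact (Submodule.Quotient.mk_eq_zero R).2 x.2)
  have hS : S.ShortExact := ModuleCat.shortComplex_shortExact S
    (fun x ↦ Subtype.ext_iff.trans (hfg x)) hf g.hom.surjective_rangeRestrict
  have hT : T.ShortExact := ModuleCat.shortComplex_shortExact T
    (LinearMap.exact_subtype_mkQ R) R.injective_subtype R.mkQ_surjective
  exact (hT.hasProjectiveDimensionLT_X₃_iff (n + 1) hQ).trans
    (hS.hasProjectiveDimensionLT_X₃_iff n hP)

end Homological

section HomFunctor

variable {Λ} (M : ModuleCat.{u} Λ)

/-- The functor `Hom_Λ(M, -)` with values in modules over `End_Λ(M)ᵒᵖ = End (op M)`. -/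
def homFunctor : ModuleCat.{u} Λ ⥤ ModuleCat.{u} (End (op M)) :=
  opOp _ ⋙ preadditiveYonedaObj (op M)

instance : (homFunctor M).Additive where
  map_add {_ _ f g} := by
    ext x
    exact congrArg Quiver.Hom.op (Preadditive.comp_add _ _ _ (Quiver.Hom.unop x) f g)

variable {M}

/-- A morphism out of `M`, as an element of the module `Hom_Λ(M, X)`. -/
def toHom {X : ModuleCat.{u} Λ} : (M ⟶ X) ≃+ (homFunctor M).obj X where
  toFun f := f.op
  invFun f := Quiver.Hom.unop f
  map_add' _ _ := rfl

lemma homFunctor_map_toHom {X Y : ModuleCat.{u} Λ} (f : X ⟶ Y) (m : M ⟶ X) :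
    (homFunctor M).map f (toHom m) = toHom (m ≫ f) := rfl

lemma smul_toHom {X : ModuleCat.{u} Λ} (r : End (op M)) (m : M ⟶ X) :
    r • toHom m = toHom (Quiver.Hom.unop r ≫ m) := rfl

lemma projective_homFunctor_self : Projective ((homFunctor M).obj M) :=
  inferInstanceAs (Projective (ModuleCat.of (End (op M)) (End (op M))))

lemma InAdd.exists_retract {X : ModuleCat.{u} Λ} (h : InAdd Λ M X) :
    ∃ (r : ℕ) (i : X ⟶ ⨁ (fun _ : Fin r ↦ M)) (p : (⨁ (fun _ : Fin r ↦ M)) ⟶ X), i ≫ p = 𝟙 X := by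
  obtain ⟨r, Y, ⟨e⟩⟩ := h
  exact ⟨r, biprod.inl ≫ e.hom, e.inv ≫ biprod.fst, by simp⟩

lemma inAdd_of_retract {X : ModuleCat.{u} Λ} {r : ℕ} (i : X ⟶ ⨁ (fun _ : Fin r ↦ M))
    (p : (⨁ (fun _ : Fin r ↦ M)) ⟶ X) (h : i ≫ p = 𝟙 X) : InAdd Λ M X := by
  have : IsSplitMono i := ⟨⟨p, h⟩⟩
  let S := ShortComplex.mk i (cokernel.π i) (cokernel.condition i)
  let s : S.Splitting := .ofExactOfRetraction S (ShortComplex.exact_cokernel i) p h inferInstance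
  exact ⟨r, cokernel i, ⟨s.isoBinaryBiproduct.symm⟩⟩

lemma InAdd.of_retract {X Y : ModuleCat.{u} Λ} (hY : InAdd Λ M Y) (i : X ⟶ Y) (p : Y ⟶ X)
    (h : i ≫ p = 𝟙 X) : InAdd Λ M X := by
  obtain ⟨r, j, q, hjq⟩ := hY.exists_retract
  exact inAdd_of_retract (i ≫ j) (q ≫ p) (by simp [reassoc_of% hjq, h])

lemma inAdd_biproduct (r : ℕ) : InAdd Λ M (⨁ (fun _ : Fin r ↦ M)) :=
  inAdd_of_retract (𝟙 _) (𝟙 _) (by simp)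

lemma inAdd_self : InAdd Λ M M :=
  inAdd_of_retract (biproduct.ι (fun _ : Fin 1 ↦ M) 0) (biproduct.π _ 0) (by simp)

lemma projective_biproduct {A : Type u} [Ring A] {P : ModuleCat.{u} A} (r : ℕ)
    (hP : Projective P) : Projective (⨁ (fun _ : Fin r ↦ P)) where
  factors f e _ := ⟨biproduct.desc fun j ↦
      Projective.factorThru (biproduct.ι (fun _ : Fin r ↦ P) j ≫ f) e,
    biproduct.hom_ext' _ _ fun j ↦ by simp⟩

lemma apply_toHom_comp {X Y : ModuleCat.{u} Λ} (φ : (homFunctor M).obj X ⟶ (homFunctor M).obj Y)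
    (a : M ⟶ M) (b : M ⟶ X) :
    φ (toHom (a ≫ b)) = toHom (a ≫ toHom.symm (φ (toHom b))) :=
  φ.hom.map_smul (M₂ := (homFunctor M).obj Y) (show End (op M) from a.op) (toHom b)

lemma InAdd.projective_homFunctor {X : ModuleCat.{u} Λ} (h : InAdd Λ M X) :
    Projective ((homFunctor M).obj X) := by
  obtain ⟨r, i, p, hip⟩ := h.exists_retract
  have := projective_homFunctor_self (M := M)
  have : Projective ((homFunctor M).obj (⨁ (fun _ : Fin r ↦ M))) :=
    Projective.of_iso ((homFunctor M).mapBiproduct (fun _ : Fin r ↦ M)).symm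
      (projective_biproduct r this)
  let ρ : Retract X (⨁ (fun _ : Fin r ↦ M)) := ⟨i, p, hip⟩
  exact (ρ.map (homFunctor M)).projective

lemma sum_π_ι {X Y : ModuleCat.{u} Λ} {r : ℕ} (a : X ⟶ ⨁ (fun _ : Fin r ↦ M))
    (b : (⨁ (fun _ : Fin r ↦ M)) ⟶ Y) :
    ∑ j, (a ≫ biproduct.π (fun _ : Fin r ↦ M) j) ≫ biproduct.ι (fun _ : Fin r ↦ M) j ≫ b =
      a ≫ b := by
  conv_rhs => rw [← Category.comp_id a, ← biproduct.total, Preadditive.comp_sum,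
    Preadditive.sum_comp]
  simp

/-- `Hom_Λ(M, -)` is full on maps out of objects of `add M`. -/
lemma InAdd.exists_map_eq {X Y : ModuleCat.{u} Λ} (h : InAdd Λ M X)
    (φ : (homFunctor M).obj X ⟶ (homFunctor M).obj Y) : ∃ f, (homFunctor M).map f = φ := by
  obtain ⟨r, i, p, hip⟩ := h.exists_retract
  let f : (⨁ (fun _ : Fin r ↦ M)) ⟶ Y :=
    biproduct.desc fun j ↦ toHom.symm (φ (toHom (biproduct.ι (fun _ : Fin r ↦ M) j ≫ p)))
  refine ⟨i ≫ f, ?_⟩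
  ext x
  obtain ⟨m, rfl⟩ := toHom.surjective x
  have hm : m = ∑ j, ((m ≫ i) ≫ biproduct.π (fun _ : Fin r ↦ M) j) ≫
      biproduct.ι (fun _ : Fin r ↦ M) j ≫ p := by
    rw [sum_π_ι, Category.assoc, hip, Category.comp_id]
  rw [homFunctor_map_toHom, ← Category.assoc, ← sum_π_ι]
  conv_rhs => rw [hm]
  simp only [map_sum, apply_toHom_comp]
  simp [f]

lemma isSeparator_of_inAdd (h : InAdd Λ M (ModuleCat.of Λ Λ)) {X Y : ModuleCat.{u} Λ}
    {f g : X ⟶ Y} (hfg : ∀ m : M ⟶ X, m ≫ f = m ≫ g) : f = g := by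
  obtain ⟨r, i, p, hip⟩ := h.exists_retract
  ext x
  let t : ModuleCat.of Λ Λ ⟶ X := ModuleCat.ofHom (LinearMap.toSpanSingleton Λ X x)
  have ht : t ≫ f = t ≫ g := by
    have : p ≫ t ≫ f = p ≫ t ≫ g := by
      refine biproduct.hom_ext' _ _ fun j ↦ ?_
      simpa using hfg (biproduct.ι (fun _ : Fin r ↦ M) j ≫ p ≫ t)
    simpa [reassoc_of% hip] using i ≫= this
  simpa [t] using ConcreteCategory.congr_hom ht (1 : Λ)

end HomFunctor

section Finite

open scoped ModuleCat

variable (k : Type u) [Field k] {Λ} [Algebra k Λ]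

lemma finite_iff_finite_algebra [FiniteDimensional k Λ] (X : ModuleCat.{u} Λ) :
    Module.Finite Λ X ↔ Module.Finite k X :=
  ⟨fun _ ↦ Module.Finite.trans Λ X, fun _ ↦ Module.Finite.of_restrictScalars_finite k Λ X⟩

lemma finite_hom (M X : ModuleCat.{u} Λ) [Module.Finite k M] [Module.Finite k X] :
    Module.Finite k (M ⟶ X) := by
  let φ : (M ⟶ X) →ₗ[k] (M →ₗ[k] X) :=
    { toFun f := f.hom.restrictScalars k
      map_add' _ _ := rfl
      map_smul' _ _ := rfl }
  exact Module.Finite.of_injective φ fun f g h ↦ by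
    ext x
    exact LinearMap.congr_fun h x

lemma isNoetherian_homFunctor (M X : ModuleCat.{u} Λ) [Module.Finite k M] [Module.Finite k X] :
    IsNoetherian (End (op M)) ((homFunctor M).obj X) := by
  have := finite_hom k M X
  let Φ : Submodule (End (op M)) ((homFunctor M).obj X) → Submodule k (M ⟶ X) := fun I ↦
    { carrier := {f | toHom f ∈ I}
      add_mem' := fun {f g} hf hg ↦ by simpa using! I.add_mem hf hg
      zero_mem' := by simp
      smul_mem' := fun c f hf ↦ by
        have := I.smul_mem (show End (op M) from (c • 𝟙 M).op) hf
        rw [smul_toHom] at this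
        simpa using! this }
  have hΦ : StrictMono Φ := by
    refine Monotone.strictMono_of_injective (fun I J h f hf ↦ h hf) fun I J h ↦ ?_
    ext x
    obtain ⟨f, rfl⟩ := toHom.surjective x
    exact SetLike.ext_iff.1 h f
  have : WellFoundedGT (Submodule k (M ⟶ X)) := inferInstance
  exact isNoetherian_iff'.2 hΦ.wellFoundedGT

lemma exists_range_eq (M X : ModuleCat.{u} Λ) [Module.Finite k M] [Module.Finite k X]
    (I : Submodule (End (op M)) ((homFunctor M).obj X)) :
    ∃ (r : ℕ) (g : (⨁ (fun _ : Fin r ↦ M)) ⟶ X),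
      LinearMap.range ((homFunctor M).map g).hom = I := by
  have := isNoetherian_homFunctor k M X
  obtain ⟨r, s, hs⟩ := Submodule.fg_iff_exists_fin_generating_family.1 (IsNoetherian.noetherian I)
  let g : (⨁ (fun _ : Fin r ↦ M)) ⟶ X := biproduct.desc fun j ↦ toHom.symm (s j)
  refine ⟨r, g, le_antisymm ?_ ?_⟩
  · rintro _ ⟨x, rfl⟩
    obtain ⟨m, rfl⟩ := toHom.surjective x
    have hm : m ≫ g = ∑ j, (m ≫ biproduct.π (fun _ : Fin r ↦ M) j) ≫ toHom.symm (s j) := by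
      rw [← sum_π_ι]
      simp [g]
    change toHom (m ≫ g) ∈ I
    rw [hm, map_sum]
    refine I.sum_mem fun j _ ↦ ?_
    exact I.smul_mem (show End (op M) from (m ≫ biproduct.π (fun _ : Fin r ↦ M) j).op)
      (hs ▸ Submodule.subset_span ⟨j, rfl⟩)
  · rw [← hs, Submodule.span_le]
    rintro _ ⟨j, rfl⟩
    refine ⟨toHom (biproduct.ι (fun _ : Fin r ↦ M) j), ?_⟩
    change toHom (biproduct.ι (fun _ : Fin r ↦ M) j ≫ g) = _
    simp [g]

lemma InAdd.finite {M X : ModuleCat.{u} Λ} [Module.Finite Λ M] (h : InAdd Λ M X) :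
    Module.Finite Λ X := by
  obtain ⟨r, i, p, hip⟩ := h.exists_retract
  have e := (ModuleCat.biproductIsoPi (fun _ : Fin r ↦ M)).toLinearEquiv
  have : Module.Finite Λ (⨁ (fun _ : Fin r ↦ M) : ModuleCat Λ) := Module.Finite.equiv e.symm
  exact Module.Finite.of_surjective p.hom fun x ↦ ⟨i x, ConcreteCategory.congr_hom hip x⟩

/-- Every finitely generated module embeds in a finitely generated injective module. -/
lemma exists_finite_injective [FiniteDimensional k Λ] (X : ModuleCat.{u} Λ) [Module.Finite Λ X] :
    ∃ (I : ModuleCat.{u} Λ) (f : X ⟶ I), Module.Finite Λ I ∧ Injective I ∧ Mono f := by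
  let φ := algebraMap k Λ
  let V := (ModuleCat.restrictScalars φ).obj X
  let adj := ModuleCat.restrictCoextendScalarsAdj.{u} φ
  have hX : Module.Finite k X := (finite_iff_finite_algebra k X).1 inferInstance
  have hV : Module.Finite k V := hX
  have hΛ : Module.Finite k ((ModuleCat.restrictScalars φ).obj (ModuleCat.of Λ Λ)) :=
    (finite_iff_finite_algebra k (ModuleCat.of Λ Λ)).1 (inferInstanceAs (Module.Finite Λ Λ))
  have hinj : Injective V := Module.injective_object_of_injective_module k V
    (inj := Module.injective_of_isSemisimpleRing k V)
  refine ⟨(ModuleCat.coextendScalars φ).obj V, adj.unit.app X, ?_,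
    Injective.injective_of_adjoint adj V, ?_⟩
  · let e : ((ModuleCat.restrictScalars φ).obj (ModuleCat.of Λ Λ) →ₗ[k] V) ≃ₗ[k]
        (ModuleCat.coextendScalars φ).obj V :=
      { (ModuleCat.CoextendScalars.equiv φ V).symm.toAddEquiv with
        map_smul' := fun c g ↦ by
          apply ModuleCat.CoextendScalars.ext
          ext s
          have h : φ c * (show Λ from s) = (show Λ from s) * φ c := Algebra.commutes c _
          exact (g.map_smul c s).symm.trans (congrArg g h) }
    exact (finite_iff_finite_algebra k _).2 (Module.Finite.equiv e)
  · rw [ModuleCat.mono_iff_injective]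
    intro x y hxy
    have := congrArg (fun g ↦ ModuleCat.CoextendScalars.equiv φ V g (1 : Λ)) hxy
    exact (one_smul Λ x).symm.trans (Eq.trans this (one_smul Λ y))

end Finite

section Approximation

open scoped ModuleCat

variable {Λ} {M : ModuleCat.{u} Λ}

lemma homFunctor_exact {X Y Z : ModuleCat.{u} Λ} (f : X ⟶ Y) (g : Y ⟶ Z) [Mono f]
    (w : f ≫ g = 0) (ex : (ShortComplex.mk f g w).Exact) :
    Function.Exact ((homFunctor M).map f) ((homFunctor M).map g) := by
  intro y
  obtain ⟨m, rfl⟩ := toHom.surjective y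
  rw [homFunctor_map_toHom, map_eq_zero_iff _ toHom.injective]
  constructor
  · intro hm
    exact ⟨toHom (ex.lift m hm), congrArg toHom (ex.lift_f m hm)⟩
  · rintro ⟨x, hx⟩
    obtain ⟨m', rfl⟩ := toHom.surjective x
    have : m' ≫ f = m := toHom.injective hx
    rw [← this, Category.assoc, w, comp_zero]

lemma homFunctor_injective {X Y : ModuleCat.{u} Λ} (f : X ⟶ Y) [Mono f] :
    Function.Injective ((homFunctor M).map f) := by
  intro x y h
  obtain ⟨m, rfl⟩ := toHom.surjective x
  obtain ⟨m', rfl⟩ := toHom.surjective y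
  exact congrArg toHom ((cancel_mono f).1 (toHom.injective h))

lemma InAdd.exists_lift {A X T : ModuleCat.{u} Λ} (hT : InAdd Λ M T) (g : A ⟶ X)
    (hg : ∀ m : M ⟶ X, ∃ h, h ≫ g = m) (f : T ⟶ X) : ∃ h, h ≫ g = f := by
  obtain ⟨r, i, p, hip⟩ := hT.exists_retract
  choose s hs using fun j ↦ hg (biproduct.ι (fun _ : Fin r ↦ M) j ≫ p ≫ f)
  refine ⟨i ≫ biproduct.desc s, ?_⟩
  have : biproduct.desc s ≫ g = p ≫ f := biproduct.hom_ext' _ _ fun j ↦ by simp [hs]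
  rw [Category.assoc, this, reassoc_of% hip]

lemma IsRMApprox.shortExact {A X : ModuleCat.{u} Λ} {g : A ⟶ X} (hg : IsRMApprox Λ M g) :
    (ShortComplex.mk ((homFunctor M).map (kernel.ι g)) ((homFunctor M).map g)
      (by rw [← Functor.map_comp, kernel.condition, Functor.map_zero])).ShortExact := by
  refine ModuleCat.shortComplex_shortExact _
    (homFunctor_exact _ _ (kernel.condition g) (ShortComplex.exact_kernel g))
    (homFunctor_injective _) fun x ↦ ?_
  obtain ⟨m, rfl⟩ := toHom.surjective x
  obtain ⟨h, hh⟩ := hg.2.1 M inAdd_self m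
  exact ⟨toHom h, congrArg toHom hh⟩

lemma IsMSyzygy.hasProjectiveDimensionLT {X W : ModuleCat.{u} Λ} {r : ℕ}
    (h : IsMSyzygy Λ M X r W) {n : ℕ}
    (hW : HasProjectiveDimensionLT ((homFunctor M).obj W) (n + 1)) :
    HasProjectiveDimensionLT ((homFunctor M).obj X) (n + r + 1) := by
  induction h generalizing n with
  | zero => exact hW
  | succ r W A g _ hg ih =>
    rw [← add_assoc, add_right_comm n]
    exact ih ((hg.shortExact.hasProjectiveDimensionLT_X₃_iff n hg.1.projective_homFunctor).2 hW)

lemma exists_isRMApprox (k : Type u) [Field k] [Algebra k Λ] [FiniteDimensional k Λ]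
    [Module.Finite Λ M] (X : ModuleCat.{u} Λ) [Module.Finite Λ X] :
    ∃ (A : ModuleCat.{u} Λ) (g : A ⟶ X), IsRMApprox Λ M g := by
  classical
  have hM := (finite_iff_finite_algebra k M).1 inferInstance
  have hX := (finite_iff_finite_algebra k X).1 inferInstance
  have hex : ∃ n, ∃ (A : ModuleCat.{u} Λ) (g : A ⟶ X), InAdd Λ M A ∧
      (∀ m : M ⟶ X, ∃ h, h ≫ g = m) ∧ Module.finrank k A = n := by
    obtain ⟨r, g, hg⟩ := exists_range_eq k M X ⊤
    refine ⟨_, _, g, inAdd_biproduct r, fun m ↦ ?_, rfl⟩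
    obtain ⟨y, hy⟩ := LinearMap.range_eq_top.1 hg (toHom m)
    obtain ⟨h, rfl⟩ := toHom.surjective y
    exact ⟨h, toHom.injective hy⟩
  obtain ⟨A, g, hA, hg, hn⟩ := Nat.find_spec hex
  refine ⟨A, g, hA, fun T hT f ↦ hT.exists_lift g hg f, fun h hh ↦ ?_⟩
  have hAfin := hA.finite
  have hAk := (finite_iff_finite_algebra k A).1 inferInstance
  have : IsArtinianRing Λ := IsArtinianRing.of_finite k Λ
  have : IsNoetherianRing Λ := IsNoetherianRing.of_finite k Λ
  obtain ⟨n, hn1, hc⟩ := ((Filter.eventually_ge_atTop 1).and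
    (LinearMap.eventually_isCompl_ker_pow_range_pow h.hom)).exists
  let q := h.hom ^ n
  let R := LinearMap.range q
  have hq : ModuleCat.ofHom q ≫ g = g := by
    have : ∀ n, ModuleCat.ofHom (h.hom ^ n) ≫ g = g := by
      intro n
      induction n with
      | zero => exact Category.id_comp g
      | succ n ih =>
        have : ModuleCat.ofHom (h.hom ^ (n + 1)) = h ≫ ModuleCat.ofHom (h.hom ^ n) := by
          rw [pow_succ]; rfl
        rw [this, Category.assoc, ih, hh]
    exact this n
  let i : ModuleCat.of Λ R ⟶ A := ModuleCat.ofHom R.subtype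
  have hR : InAdd Λ M (ModuleCat.of Λ R) :=
    hA.of_retract i (ModuleCat.ofHom (Submodule.projectionOnto R _ hc.symm)) (by
      ext x
      exact congrArg Subtype.val (Submodule.projectionOnto_apply_left hc.symm x))
  have hRg (m : M ⟶ X) : ∃ t, t ≫ i ≫ g = m := by
    obtain ⟨t, rfl⟩ := hg m
    refine ⟨t ≫ ModuleCat.ofHom q.rangeRestrict, ?_⟩
    have : ModuleCat.ofHom q.rangeRestrict ≫ i = ModuleCat.ofHom q := rfl
    rw [Category.assoc, reassoc_of% this, hq]
  have hle : Module.finrank k A ≤ Module.finrank k (ModuleCat.of Λ R) :=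
    hn ▸ Nat.find_min' hex ⟨_, i ≫ g, hR, hRg, rfl⟩
  have hRk : Module.Finite k (ModuleCat.of Λ R) := (finite_iff_finite_algebra k _).1 hR.finite
  have hinj : Function.Injective (i.hom.restrictScalars k) := Subtype.val_injective
  have hsurj := (LinearMap.injective_iff_surjective_of_finrank_eq_finrank
    (le_antisymm (LinearMap.finrank_le_finrank_of_injective hinj) hle)).1 hinj
  have hq' : Function.Surjective q := fun x ↦ by
    obtain ⟨⟨_, y, rfl⟩, rfl⟩ := hsurj x
    exact ⟨y, rfl⟩
  have hh' : Function.Surjective h.hom := by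
    obtain ⟨m, rfl⟩ := Nat.exists_eq_add_of_le' hn1
    intro x
    obtain ⟨y, rfl⟩ := hq' x
    exact ⟨(h.hom ^ m) y, by simp [q, pow_succ']⟩
  have : Epi h := (ModuleCat.epi_iff_surjective h).2 hh'
  have : Mono h := (ModuleCat.mono_iff_injective h).2
    (IsNoetherian.injective_of_surjective_endomorphism h.hom hh')
  exact isIso_of_mono_of_epi h

lemma inAdd_of_projective (k : Type u) [Field k] [Algebra k Λ] [FiniteDimensional k Λ]
    [Module.Finite Λ M] (hΛ : InAdd Λ M (ModuleCat.of Λ Λ)) (W : ModuleCat.{u} Λ)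
    [Module.Finite Λ W] (hW : Projective ((homFunctor M).obj W)) : InAdd Λ M W := by
  obtain ⟨A, g, hg⟩ := exists_isRMApprox k W (M := M)
  have : Epi ((homFunctor M).map g) := hg.shortExact.epi_g
  let s := Projective.factorThru (𝟙 _) ((homFunctor M).map g)
  have hs : s ≫ (homFunctor M).map g = 𝟙 _ := Projective.factorThru_comp _ _
  obtain ⟨h, hh⟩ := hg.1.exists_map_eq ((homFunctor M).map g ≫ s)
  have hFg : (homFunctor M).map (h ≫ g) = (homFunctor M).map g := by
    rw [Functor.map_comp, hh, Category.assoc, hs, Category.comp_id]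
  have hhg : h ≫ g = g := isSeparator_of_inAdd hΛ fun m ↦
    toHom.injective (ConcreteCategory.congr_hom hFg (toHom m))
  have := hg.2.2 h hhg
  have hmono : Mono ((homFunctor M).map g) := by
    have : Mono ((homFunctor M).map g ≫ s) := hh ▸ inferInstance
    exact mono_of_mono _ s
  have hinj := (ModuleCat.mono_iff_injective _).1 hmono
  have : Mono g := ⟨fun a b hab ↦ isSeparator_of_inAdd hΛ fun m ↦
    toHom.injective (hinj (by simp [homFunctor_map_toHom, hab]))⟩
  have : Epi g := by
    rw [ModuleCat.epi_iff_surjective]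
    intro x
    obtain ⟨t, ht⟩ := hg.2.1 _ hΛ (ModuleCat.ofHom (LinearMap.toSpanSingleton Λ W x))
    refine ⟨t (1 : Λ), ?_⟩
    simpa using ConcreteCategory.congr_hom ht (1 : Λ)
  have : IsIso g := isIso_of_mono_of_epi g
  exact hg.1.of_retract (inv g) g (by simp)

end Approximation

section GlobalDimension

open scoped ModuleCat

variable {Λ} {M : ModuleCat.{u} Λ}

lemma hasProjectiveDimensionLT_homFunctor_biprod {A B : ModuleCat.{u} Λ} {n : ℕ}
    (hA : HasProjectiveDimensionLT ((homFunctor M).obj A) n)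
    (hB : HasProjectiveDimensionLT ((homFunctor M).obj B) n) :
    HasProjectiveDimensionLT ((homFunctor M).obj (A ⊞ B)) n :=
  have : PreservesBinaryBiproducts (homFunctor M) :=
    preservesBinaryBiproducts_of_preservesBiproducts _
  hasProjectiveDimensionLT_of_iso ((homFunctor M).mapBiprod A B).symm n

lemma MdimLE.hasProjectiveDimensionLT {X : ModuleCat.{u} Λ} {n : ℕ} (h : MdimLE Λ M X n) :
    HasProjectiveDimensionLT ((homFunctor M).obj X) (n + 1) := by
  obtain ⟨W, hW, hWM⟩ := h
  simpa using hW.hasProjectiveDimensionLT (n := 0)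
    (projective_iff_hasProjectiveDimensionLT_one.1 hWM.projective_homFunctor)

lemma nontrivial_of_not_isZero {X : ModuleCat.{u} Λ} (h : ¬ IsZero X) : Nontrivial X := by
  by_contra h'
  have := not_nontrivial_iff_subsingleton.1 h'
  exact h (ModuleCat.isZero_of_subsingleton X)

lemma hasProjectiveDimensionLT_of_indec (k : Type u) [Field k] [Algebra k Λ]
    [FiniteDimensional k Λ] (n : ℕ)
    (h : ∀ X : ModuleCat.{u} Λ, Module.Finite Λ X → Indec Λ X → MdimLE Λ M X n)
    (X : ModuleCat.{u} Λ) (hX : Module.Finite Λ X) :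
    HasProjectiveDimensionLT ((homFunctor M).obj X) (n + 1) := by
  induction hr : Module.finrank k X using Nat.strong_induction_on generalizing X with
  | _ r ih =>
  by_cases h0 : IsZero X
  · have : Projective ((homFunctor M).obj X) := ((homFunctor M).map_isZero h0).projective
    exact hasProjectiveDimensionLT_of_ge _ 1 (n + 1) (by lia)
  by_cases hi : Indec Λ X
  · exact (h X hX hi).hasProjectiveDimensionLT
  simp only [Indec, not_and, not_forall, not_or] at hi
  obtain ⟨A, B, ⟨e⟩, hA, hB⟩ := hi h0
  have e' : X ≃ₗ[Λ] (A × B) := (e ≪≫ ModuleCat.biprodIsoProd A B).toLinearEquiv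
  have hAf : Module.Finite Λ A :=
    Module.Finite.of_surjective (LinearMap.fst Λ A B ∘ₗ e'.toLinearMap)
      (Prod.fst_surjective.comp e'.surjective)
  have hBf : Module.Finite Λ B :=
    Module.Finite.of_surjective (LinearMap.snd Λ A B ∘ₗ e'.toLinearMap)
      (Prod.snd_surjective.comp e'.surjective)
  have hAk := (finite_iff_finite_algebra k A).1 hAf
  have hBk := (finite_iff_finite_algebra k B).1 hBf
  have hAn := nontrivial_of_not_isZero hA
  have hBn := nontrivial_of_not_isZero hB
  have hA0 : 0 < Module.finrank k A := Module.finrank_pos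
  have hB0 : 0 < Module.finrank k B := Module.finrank_pos
  have hX' : Module.finrank k X = Module.finrank k A + Module.finrank k B :=
    (e'.restrictScalars k).finrank_eq.trans Module.finrank_prod
  have := hasProjectiveDimensionLT_homFunctor_biprod
    (ih _ (by lia) A hAf rfl) (ih _ (by lia) B hBf rfl)
  exact hasProjectiveDimensionLT_of_iso ((homFunctor M).mapIso e.symm) (n + 1)

lemma finite_kernel [IsNoetherianRing Λ] {X Y : ModuleCat.{u} Λ} [Module.Finite Λ X] (g : X ⟶ Y) :
    Module.Finite Λ (kernel g : ModuleCat Λ) :=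
  Module.Finite.of_injective (kernel.ι g).hom ((ModuleCat.mono_iff_injective _).1 inferInstance)

/-- If `Hom_Λ(M, X)` has finite projective dimension, then it is computed by the `M`-syzygies. -/
lemma exists_isMSyzygy (k : Type u) [Field k] [Algebra k Λ] [FiniteDimensional k Λ]
    [Module.Finite Λ M] {X : ModuleCat.{u} Λ} [Module.Finite Λ X] (r s : ℕ)
    (h : HasProjectiveDimensionLT ((homFunctor M).obj X) (s + r + 1)) :
    ∃ W : ModuleCat.{u} Λ, Module.Finite Λ W ∧ IsMSyzygy Λ M X r W ∧
      HasProjectiveDimensionLT ((homFunctor M).obj W) (s + 1) := by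
  have : IsNoetherianRing Λ := IsNoetherianRing.of_finite k Λ
  induction r generalizing s with
  | zero => exact ⟨X, inferInstance, .zero X, h⟩
  | succ r ih =>
    obtain ⟨W, hWf, hW, hpd⟩ := ih (s + 1) (by rwa [add_right_comm s 1 r])
    obtain ⟨A, g, hg⟩ := exists_isRMApprox k W (M := M)
    have := hg.1.finite
    exact ⟨kernel g, finite_kernel g, .succ X r W A g hW hg,
      (hg.shortExact.hasProjectiveDimensionLT_X₃_iff s hg.1.projective_homFunctor).1 hpd⟩

lemma mdimLE_iff (k : Type u) [Field k] [Algebra k Λ] [FiniteDimensional k Λ]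
    [Module.Finite Λ M] (hΛ : InAdd Λ M (ModuleCat.of Λ Λ)) (X : ModuleCat.{u} Λ)
    [Module.Finite Λ X] (n : ℕ) :
    MdimLE Λ M X n ↔ HasProjectiveDimensionLT ((homFunctor M).obj X) (n + 1) := by
  refine ⟨MdimLE.hasProjectiveDimensionLT, fun h ↦ ?_⟩
  obtain ⟨W, _, hW, hpd⟩ := exists_isMSyzygy k n 0 (by rwa [zero_add])
  exact ⟨W, hW, inAdd_of_projective k hΛ W (projective_iff_hasProjectiveDimensionLT_one.2 hpd)⟩

lemma gldimLE_of_hasProjectiveDimensionLT (k : Type u) [Field k] [Algebra k Λ]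
    [FiniteDimensional k Λ] [Module.Finite Λ M] (n : ℕ)
    (h : ∀ X : ModuleCat.{u} Λ, Module.Finite Λ X →
      HasProjectiveDimensionLT ((homFunctor M).obj X) (n + 1)) :
    GldimLE (End (op M)) (n + 2) := by
  have : IsNoetherianRing Λ := IsNoetherianRing.of_finite k Λ
  have hM := (finite_iff_finite_algebra k M).1 inferInstance
  refine fun N ↦ projDimLE_of_hasProjectiveDimensionLT
    (hasProjectiveDimensionLT_of_cyclic (n + 2) (fun I ↦ ?_) N)
  obtain ⟨r, g, hg⟩ := exists_range_eq k M M I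
  have := (inAdd_biproduct (M := M) r).finite
  have key := (hasProjectiveDimensionLT_quotient_range_iff
    (inAdd_biproduct r).projective_homFunctor projective_homFunctor_self
    ((homFunctor M).map (kernel.ι g)) ((homFunctor M).map g) (homFunctor_injective _)
    (homFunctor_exact _ _ (kernel.condition g) (ShortComplex.exact_kernel g)) n).2
    (h _ (finite_kernel g))
  rw [hg] at key
  exact key

lemma GldimLE.hasProjectiveDimensionLT_homFunctor (k : Type u) [Field k] [Algebra k Λ]
    [FiniteDimensional k Λ] (hgc : IsGenCogen Λ M) {n : ℕ}
    (h : GldimLE (End (op M)) (n + 2)) (X : ModuleCat.{u} Λ) [Module.Finite Λ X] :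
    HasProjectiveDimensionLT ((homFunctor M).obj X) (n + 1) := by
  obtain ⟨I, f, hIf, hI, hf⟩ := exists_finite_injective k X
  have : Module.Finite Λ (cokernel f : ModuleCat Λ) := Module.Finite.of_surjective
    (cokernel.π f).hom ((ModuleCat.epi_iff_surjective _).1 inferInstance)
  obtain ⟨J, j, hJf, hJ, hj⟩ := exists_finite_injective k (cokernel f)
  let φ : ShortComplex.mk f (cokernel.π f) (cokernel.condition f) ⟶
      ShortComplex.mk f (cokernel.π f ≫ j) (by simp) := { τ₁ := 𝟙 _, τ₂ := 𝟙 _, τ₃ := j }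
  have : Epi φ.τ₁ := inferInstanceAs (Epi (𝟙 _))
  have : IsIso φ.τ₂ := inferInstanceAs (IsIso (𝟙 _))
  have ex := (ShortComplex.exact_iff_of_epi_of_isIso_of_mono φ).1 (ShortComplex.exact_cokernel f)
  exact (hasProjectiveDimensionLT_quotient_range_iff
    (hgc.2 I hIf hI).projective_homFunctor (hgc.2 J hJf hJ).projective_homFunctor
    ((homFunctor M).map f) ((homFunctor M).map (cokernel.π f ≫ j)) (homFunctor_injective _)
    (homFunctor_exact _ _ _ ex) n).1 (h _).hasProjectiveDimensionLT

end GlobalDimension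

/-- Lemma `AUS`: for a generator-cogenerator `M` and `d ≥ 2`,
`gldim End_Λ(M) ≤ d` iff every indecomposable `Λ`-module has `M`-dimension `≤ d - 2`. -/
theorem statement2 (k : Type u) [Field k] (Λ : Type u) [Ring Λ] [Algebra k Λ]
    [FiniteDimensional k Λ]
    (M : ModuleCat.{u} Λ) (hMfin : Module.Finite Λ M) (hgc : IsGenCogen Λ M)
    (d : ℕ) (hd : 2 ≤ d) :
    GldimLE (End (op M)) d ↔
      ∀ X : ModuleCat.{u} Λ, Module.Finite Λ X → Indec Λ X → MdimLE Λ M X (d - 2) := by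
  obtain ⟨n, rfl⟩ := Nat.exists_eq_add_of_le' hd
  rw [Nat.add_sub_cancel]
  exact ⟨fun h X _ _ ↦ (mdimLE_iff k hgc.1 X n).2 (h.hasProjectiveDimensionLT_homFunctor k hgc X),
    fun h ↦ gldimLE_of_hasProjectiveDimensionLT k n (hasProjectiveDimensionLT_of_indec k n h)⟩

end Rigidity
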